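/- arXiv:1312.7405 — 8 statements merged into one kernel-verified Lean document; each statement's English description precedes it below -/
import Mathlib

section
/- If G is an r-regular graph on v vertices (v \geq 2) that admits an (a,d)-distance antimagic labeling, then d \leq r(v-r)/(v-1). -/
/-- The vertex-weight of `x` under a labeling `f`: the sum of the labels of the
neighbors of `x`. -/
noncomputable def wt {α : Type*} [Fintype α] (G : SimpleGraph α) (f : α → ℕ) (x : α) : ℕ :=
  ∑ y, (G.neighborSet x).indicator f y

/-- A graph is `(a,d)`-distance antimagic if there is a bijection from the vertices
onto `{1, …, v}` (encoded via an equivalence with `Fin v`, the label of `y` being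
`f y + 1`) such that the set of vertex-weights is exactly
`{a, a + d, …, a + (v-1)d}`. -/
def ADDistanceAntimagic {α : Type*} [Fintype α] (G : SimpleGraph α) (a d : ℤ) : Prop :=
  ∃ f : α ≃ Fin (Fintype.card α),
    (Finset.univ.image fun x => (wt G (fun y => (f y : ℕ) + 1) x : ℤ)) =
      (Finset.range (Fintype.card α)).image fun i : ℕ => a + (i : ℤ) * d

/-- Two sets of `r` integers in `[m, M]` have sums differing by at most `r (M - m + 1 - r)`. -/
lemma Finset.sum_sub_sum_le_of_card_eq {s t : Finset ℤ} {m M : ℤ} {r : ℕ}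
    (hs : s.card = r) (ht : t.card = r) (hM : ∀ x ∈ s, x ≤ M) (hm : ∀ x ∈ t, m ≤ x) :
    ∑ x ∈ s, x - ∑ x ∈ t, x ≤ r * (M - m + 1 - r) := by
  have h₁ := Finset.sum_le_sum_range hM
  have h₂ := Finset.sum_range_le_sum hm
  have h₃ : ∀ n : ℕ, ∑ i ∈ Finset.range n, (M - (i : ℤ)) - ∑ i ∈ Finset.range n, (m + (i : ℤ)) =
      n * (M - m + 1 - n) := by
    intro n
    induction n with
    | zero => simp
    | succ n ih =>
      rw [Finset.sum_range_succ, Finset.sum_range_succ]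
      push_cast
      linear_combination ih
  rw [hs] at h₁
  rw [ht] at h₂
  linarith [h₃ r]

/-- The weight of a vertex under an injective labeling is the sum of the set of labels of its
neighbors. -/
lemma wt_eq_sum_image {α : Type*} [Fintype α] (G : SimpleGraph α) [DecidableRel G.Adj]
    {f : α → ℕ} (hf : Function.Injective f) (x : α) :
    (wt G f x : ℤ) = ∑ z ∈ (G.neighborFinset x).image (fun y => (f y : ℤ)), z := by
  classical
  rw [Finset.sum_image fun _ _ _ _ h => hf (Nat.cast_injective h), wt]
  simp [Set.indicator_apply, SimpleGraph.neighborFinset_eq_filter, Finset.sum_filter]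

/-- If an `r`-regular graph on `v ≥ 2` vertices admits an `(a,d)`-distance antimagic
labeling, then `d ≤ r(v - r)/(v - 1)`. -/
theorem regular_ADDistanceAntimagic_d_le {α : Type*} [Fintype α]
    (G : SimpleGraph α) [DecidableRel G.Adj] (r : ℕ)
    (hv : 2 ≤ Fintype.card α) (hreg : G.IsRegularOfDegree r)
    (a d : ℤ) (hd : 0 ≤ d) (h : ADDistanceAntimagic G a d) :
    (d : ℚ) ≤ (r : ℚ) * ((Fintype.card α : ℚ) - (r : ℚ)) / ((Fintype.card α : ℚ) - 1) := by
  obtain ⟨f, hf⟩ := h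
  have hinj : Function.Injective (fun y => (f y : ℕ) + 1) := by
    intro x y hxy
    exact f.injective (Fin.ext (by simpa using hxy))
  have weight : ∀ i < Fintype.card α, ∃ x, (wt G (fun y => (f y : ℕ) + 1) x : ℤ) = a + (i : ℤ) * d := by
    intro i hi
    have hmem := Finset.mem_image_of_mem (fun i : ℕ => a + (i : ℤ) * d) (Finset.mem_range.2 hi)
    rw [← hf] at hmem
    simpa using hmem
  obtain ⟨x, hx⟩ := weight (Fintype.card α - 1) (by omega)
  obtain ⟨y, hy⟩ := weight 0 (by omega)
  have card_labels : ∀ x, ((G.neighborFinset x).image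
      (fun y => (((f y : ℕ) + 1 : ℕ) : ℤ))).card = r := by
    intro x
    exact (Finset.card_image_of_injective _ (Nat.cast_injective.comp hinj)).trans (hreg x)
  have hbound := Finset.sum_sub_sum_le_of_card_eq (m := 1) (M := Fintype.card α)
    (card_labels x) (card_labels y)
    (by
      simp only [Finset.forall_mem_image]
      intro z _
      have := (f z).isLt
      omega)
    (by
      simp only [Finset.forall_mem_image]
      intro z _
      omega)
  rw [← wt_eq_sum_image G hinj, ← wt_eq_sum_image G hinj, hx, hy] at hbound
  push_cast [Nat.cast_sub (show 1 ≤ Fintype.card α by omega)] at hbound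
  have hd_mul : d * ((Fintype.card α : ℤ) - 1) ≤ r * ((Fintype.card α : ℤ) - r) := by linarith
  have hv_cast : (2 : ℚ) ≤ Fintype.card α := by exact_mod_cast hv
  rw [le_div_iff₀ (by linarith)]
  exact_mod_cast hd_mul
end

section
/- For n \geq 3, the cycle C_n admits an (a,d)-distance antimagic labeling for some integers a and d \geq 0 if and only if (d = 0 and n = 4) or (d = 1 and n is odd). -/
open Fin.CommRing in
theorem wt_cycleGraph (k : ℕ) (f : Fin (k + 3) → ℕ) (v : Fin (k + 3)) :
    wt (SimpleGraph.cycleGraph (k + 3)) f v = f (v - 1) + f (v + 1) := by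
  have hne : v - 1 ≠ v + 1 := by
    intro h
    have h2 : ((2 : ℕ) : Fin (k + 3)) = 0 := by
      push_cast
      linear_combination -h
    have := Nat.le_of_dvd two_pos ((Fin.natCast_eq_zero).1 h2)
    omega
  have hset : (SimpleGraph.cycleGraph (k + 3)).neighborSet v =
      (({v - 1, v + 1} : Finset (Fin (k + 3))) : Set (Fin (k + 3))) := by
    rw [SimpleGraph.cycleGraph_neighborSet]
    simp
  rw [wt, hset, Finset.sum_indicator_subset f (Finset.subset_univ _), Finset.sum_pair hne]

theorem sum_wt_cycleGraph (k : ℕ) (f : Fin (k + 3) → ℕ) :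
    ∑ v, wt (SimpleGraph.cycleGraph (k + 3)) f v = 2 * ∑ v, f v := by
  simp only [wt_cycleGraph, Finset.sum_add_distrib]
  rw [two_mul]
  exact congrArg₂ (· + ·) (Equiv.sum_comp (Equiv.subRight (1 : Fin (k + 3))) f)
    (Equiv.sum_comp (Equiv.addRight (1 : Fin (k + 3))) f)

open Fin.CommRing in
theorem three_le_wt_cycleGraph (k : ℕ) (f : Fin (k + 3) → ℕ) (hf : Function.Injective f)
    (hpos : ∀ v, 1 ≤ f v) (v : Fin (k + 3)) :
    3 ≤ wt (SimpleGraph.cycleGraph (k + 3)) f v := by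
  have hne : f (v - 1) ≠ f (v + 1) := by
    intro h
    have h2 : ((2 : ℕ) : Fin (k + 3)) = 0 := by
      push_cast
      linear_combination -(hf h)
    have := Nat.le_of_dvd two_pos ((Fin.natCast_eq_zero).1 h2)
    omega
  have h1 := hpos (v - 1)
  have h2 := hpos (v + 1)
  rw [wt_cycleGraph]
  omega

open Fin.CommRing in
/-- If all weights on a cycle agree, an injective labeling forces the length to be four. -/
theorem eq_four_of_wt_cycleGraph_const (k : ℕ) (f : Fin (k + 3) → ℕ) (hf : Function.Injective f)
    (c : ℕ) (hc : ∀ v, wt (SimpleGraph.cycleGraph (k + 3)) f v = c) : k + 3 = 4 := by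
  have h1 := hc 1
  have h3 := hc 3
  rw [wt_cycleGraph] at h1 h3
  have e : (3 - 1 : Fin (k + 3)) = 1 + 1 := by ring
  rw [e] at h3
  have h0 : (1 - 1 : Fin (k + 3)) = 3 + 1 := hf (by omega)
  have h4 : ((4 : ℕ) : Fin (k + 3)) = 0 := by
    push_cast
    linear_combination -h0
  have hdvd := (Fin.natCast_eq_zero).1 h4
  have := Nat.le_of_dvd (by norm_num) hdvd
  have : k ≠ 0 := by
    rintro rfl
    omega
  omega

/-- Summing all weights determines `a` in terms of `d` and forces `d = 1` when `d` is positive. -/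
theorem eq_one_and_odd_of_image_wt (k : ℕ) (f : Fin (k + 3) ≃ Fin (k + 3)) (a d : ℤ) (hd : 0 < d)
    (h : (Finset.univ.image fun x =>
        (wt (SimpleGraph.cycleGraph (k + 3)) (fun y => (f y : ℕ) + 1) x : ℤ)) =
      (Finset.range (k + 3)).image fun i : ℕ => a + (i : ℤ) * d) :
    d = 1 ∧ Odd (k + 3) := by
  have hinj : Function.Injective fun i : ℕ => a + (i : ℤ) * d := by
    intro i j hij
    simpa [hd.ne'] using hij
  have hwinj : Set.InjOn (fun x =>
      (wt (SimpleGraph.cycleGraph (k + 3)) (fun y => (f y : ℕ) + 1) x : ℤ))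
      (Finset.univ : Finset (Fin (k + 3))) := by
    rw [← Finset.card_image_iff, h, Finset.card_image_of_injective _ hinj]
    simp
  have hsum := congrArg (fun s : Finset ℤ => ∑ z ∈ s, z) h
  rw [Finset.sum_image hwinj, Finset.sum_image hinj.injOn, ← Nat.cast_sum, sum_wt_cycleGraph,
    f.sum_comp (fun i : Fin (k + 3) => (i : ℕ) + 1), Fin.sum_univ_eq_sum_range (fun i => i + 1),
    Finset.sum_add_distrib, Finset.sum_add_distrib, ← Finset.sum_mul, ← Nat.cast_sum] at hsum
  have hgauss : ((∑ i ∈ Finset.range (k + 3), i : ℕ) : ℤ) * 2 = (k + 3) * (k + 2) := by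
    exact_mod_cast Finset.sum_range_id_mul_two (k + 3)
  simp only [Finset.sum_const, Finset.card_range, smul_eq_mul, nsmul_eq_mul, mul_one] at hsum
  push_cast at hsum hgauss
  have ha : 2 * (k + 4 : ℤ) = 2 * a + (k + 2) * d := by
    have : (k + 3 : ℤ) ≠ 0 := by positivity
    apply mul_left_cancel₀ this
    linear_combination 2 * hsum + (d - 2) * hgauss
  have ha3 : 3 ≤ a := by
    have hmem : a ∈ (Finset.range (k + 3)).image fun i : ℕ => a + (i : ℤ) * d :=
      Finset.mem_image.2 ⟨0, by simp, by simp⟩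
    rw [← h] at hmem
    obtain ⟨x, -, hx⟩ := Finset.mem_image.1 hmem
    have := three_le_wt_cycleGraph k (fun y => (f y : ℕ) + 1)
      (fun y z hyz => f.injective (Fin.ext (by simpa using hyz))) (fun _ => by simp) x
    rw [← hx]
    exact_mod_cast this
  have hd1 : d = 1 := by
    by_contra hne
    have : 2 ≤ d := by omega
    nlinarith
  subst hd1
  refine ⟨rfl, ?_⟩
  rw [Nat.odd_iff]
  omega

open Fin.CommRing in
/-- On a cycle of odd length `2 m + 1` the vertices can be numbered so that the numbers at
distance two differ by `m + 1`, cyclically. -/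
theorem exists_equiv_fin_add_one_eq (n m : ℕ) [NeZero n] (hn : n = 2 * m + 1) :
    ∃ f : Fin n ≃ Fin n, ∀ v, f (v + 1) = f (v - 1) + Fin.ofNat n (m + 1) := by
  change ∃ f : Fin n ≃ Fin n, ∀ v, f (v + 1) = f (v - 1) + ((m + 1 : ℕ) : Fin n)
  have h : (2 : Fin n) * ((m : Fin n) + 1) = 1 := by
    have h0 : ((2 * m + 1 : ℕ) : Fin n) = 0 := Fin.natCast_eq_zero.2 (dvd_of_eq hn)
    push_cast at h0
    linear_combination h0
  refine ⟨⟨fun v => (m + 1) ^ 2 * v, fun v => 4 * v, fun v => ?_, fun v => ?_⟩, fun v => ?_⟩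
  · linear_combination v * (2 * (m + 1) + 1) * h
  · linear_combination v * (2 * (m + 1) + 1) * h
  · push_cast
    simp only [Equiv.coe_fn_mk]
    linear_combination (m + 1) * h

theorem addDistanceAntimagic_cycleGraph_odd (k m : ℕ) (hk : k + 3 = 2 * m + 1) :
    ADDistanceAntimagic (SimpleGraph.cycleGraph (k + 3)) (m + 2) 1 := by
  obtain ⟨f, hf⟩ : ∃ f : Fin (k + 3) ≃ Fin (k + 3), ∀ v,
      (f (v + 1) : ℕ) = ((f (v - 1) : ℕ) + (m + 1)) % (k + 3) := by
    obtain ⟨f, hf⟩ := exists_equiv_fin_add_one_eq (k + 3) m hk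
    refine ⟨f, fun v => ?_⟩
    rw [hf, Fin.val_add, Fin.val_ofNat, Nat.add_mod_mod]
  have hval (v : Fin (k + 3)) : (f (v + 1) : ℕ) =
      if (f (v - 1) : ℕ) < m then (f (v - 1) : ℕ) + m + 1 else (f (v - 1) : ℕ) - m := by
    rw [hf]
    have := (f (v - 1)).isLt
    split_ifs with hlt
    · rw [Nat.mod_eq_of_lt] <;> omega
    · rw [Nat.mod_eq_sub_mod (by omega), Nat.mod_eq_of_lt] <;> omega
  refine ⟨f.trans (finCongr (Fintype.card_fin _).symm), ?_⟩
  ext z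
  simp only [wt_cycleGraph, Finset.mem_image, Finset.mem_univ, true_and, Finset.mem_range,
    Fintype.card_fin, Equiv.trans_apply, finCongr_apply, Fin.val_cast, hval, mul_one]
  constructor
  · rintro ⟨v, rfl⟩
    have := (f (v - 1)).isLt
    split_ifs with hlt
    · exact ⟨2 * (f (v - 1) : ℕ) + 1, by omega, by push_cast; ring⟩
    · exact ⟨2 * (f (v - 1) : ℕ) - 2 * m, by omega, by omega⟩
  · rintro ⟨i, hi, rfl⟩
    obtain ⟨y, hy⟩ : ∃ y : Fin (k + 3), (y : ℕ) = if i % 2 = 1 then i / 2 else i / 2 + m :=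
      ⟨⟨if i % 2 = 1 then i / 2 else i / 2 + m, by split_ifs <;> omega⟩, rfl⟩
    refine ⟨f.symm y + 1, ?_⟩
    rw [add_sub_cancel_right, f.apply_symm_apply]
    split_ifs at hy ⊢ <;> omega

theorem addDistanceAntimagic_cycleGraph_four :
    ADDistanceAntimagic (SimpleGraph.cycleGraph 4) 5 0 := by
  refine ⟨(Equiv.swap (2 : Fin 4) 3).trans (finCongr (Fintype.card_fin _).symm), ?_⟩
  simp only [wt_cycleGraph 1, Fintype.card_fin, Equiv.trans_apply, finCongr_apply, Fin.val_cast]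
  decide

/-- For `n ≥ 3`, the cycle `Cₙ` admits an `(a,d)`-distance antimagic labeling for
some `a` if and only if `d = 0` and `n = 4`, or `d = 1` and `n` is odd. -/
theorem cycle_ADDistanceAntimagic_iff (n : ℕ) (hn : 3 ≤ n) (d : ℤ) (hd : 0 ≤ d) :
    (∃ a : ℤ, ADDistanceAntimagic (SimpleGraph.cycleGraph n) a d) ↔
      (d = 0 ∧ n = 4) ∨ (d = 1 ∧ Odd n) := by
  obtain ⟨k, rfl⟩ := Nat.exists_eq_add_of_le' hn
  constructor
  · rintro ⟨a, f, hf⟩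
    rcases hd.eq_or_lt with rfl | hd
    · refine Or.inl ⟨rfl, ?_⟩
      refine eq_four_of_wt_cycleGraph_const k (fun y => (f y : ℕ) + 1)
        (fun y z hyz => f.injective (Fin.ext (by simpa using hyz))) a.toNat fun v => ?_
      have hv := Finset.mem_image_of_mem (fun x =>
        (wt (SimpleGraph.cycleGraph (k + 3)) (fun y => (f y : ℕ) + 1) x : ℤ)) (Finset.mem_univ v)
      rw [hf] at hv
      obtain ⟨i, -, hi⟩ := Finset.mem_image.1 hv
      simp only [mul_zero, add_zero] at hi
      omega
    · refine Or.inr (eq_one_and_odd_of_image_wt k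
        (f.trans (finCongr (Fintype.card_fin _))) a d hd ?_)
      simpa using hf
  · rintro (⟨rfl, hk⟩ | ⟨rfl, m, hm⟩)
    · obtain rfl : k = 1 := by omega
      exact ⟨5, addDistanceAntimagic_cycleGraph_four⟩
    · exact ⟨m + 2, addDistanceAntimagic_cycleGraph_odd k m hm⟩
end

section
/- For every n \geq 3, the sun S_n does not admit an (a,d)-distance antimagic labeling for any integers a and d \geq 0. -/
/-- The sun `Sₙ`: a cycle on vertices `Sum.inl 0, …, Sum.inl (n-1)` together with a
pendant vertex `Sum.inr i` attached to `Sum.inl i` for each `i`. -/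
def sunGraph (n : ℕ) : SimpleGraph (Fin n ⊕ Fin n) :=
  SimpleGraph.fromRel fun x y =>
    match x, y with
    | Sum.inl x, Sum.inl y => ((x : ℕ) + 1) % n = (y : ℕ)
    | Sum.inl x, Sum.inr y => x = y
    | _, _ => False

/-- The sum of the elements of a finite set of naturals is at least the sum of the first
`#s` naturals. -/
theorem card_mul_pred_le_two_mul_sum (s : Finset ℕ) :
    s.card * (s.card - 1) ≤ 2 * ∑ i ∈ s, i := by
  have h := Finset.sum_range_le_sum (s := s.map Nat.castEmbedding) (c := (0 : ℤ)) (by simp)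
  simp only [Finset.card_map, Finset.sum_map, Nat.castEmbedding_apply, zero_add] at h
  rw [← Finset.sum_range_id_mul_two, mul_comm]
  exact Nat.mul_le_mul_left 2 (by zify; exact h)

theorem sunGraph_adj_inl_inl (m : ℕ) (i j : Fin (m + 3)) :
    (sunGraph (m + 3)).Adj (Sum.inl i) (Sum.inl j) ↔ j = i + 1 ∨ j = i - 1 := by
  have key : ∀ x y : Fin (m + 3), ((x : ℕ) + 1) % (m + 3) = (y : ℕ) ↔ y = x + 1 := by
    intro x y
    simp [Fin.ext_iff, Fin.val_add, eq_comm]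
  have hne : ∀ x : Fin (m + 3), x + 1 ≠ x := by simp
  simp only [sunGraph, SimpleGraph.fromRel_adj, key, ne_eq, Sum.inl.injEq, eq_sub_iff_add_eq]
  grind

theorem sunGraph_adj_inl_inr (n : ℕ) (i j : Fin n) :
    (sunGraph n).Adj (Sum.inl i) (Sum.inr j) ↔ j = i := by
  simp [sunGraph, eq_comm]

theorem sunGraph_adj_inr_inr (n : ℕ) (i j : Fin n) :
    ¬ (sunGraph n).Adj (Sum.inr i) (Sum.inr j) := by
  simp [sunGraph]

theorem wt_sunGraph_inr (n : ℕ) (f : Fin n ⊕ Fin n → ℕ) (i : Fin n) :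
    wt (sunGraph n) f (Sum.inr i) = f (Sum.inl i) := by
  classical
  simp [wt, Set.indicator_apply, sunGraph_adj_inr_inr, SimpleGraph.adj_comm _ (Sum.inr i),
    sunGraph_adj_inl_inr]

theorem wt_sunGraph_inl (m : ℕ) (f : Fin (m + 3) ⊕ Fin (m + 3) → ℕ) (i : Fin (m + 3)) :
    wt (sunGraph (m + 3)) f (Sum.inl i) =
      f (Sum.inl (i + 1)) + f (Sum.inl (i - 1)) + f (Sum.inr i) := by
  classical
  have hne : i + 1 ≠ i - 1 := by
    intro h
    have h2 : (1 : Fin (m + 3)) + 1 = 0 := by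
      rw [eq_sub_iff_add_eq, add_assoc] at h
      simpa using h
    simp [Fin.ext_iff, Fin.val_add, Nat.mod_eq_of_lt (show 2 < m + 3 by omega)] at h2
  have hsplit : ∀ j : Fin (m + 3), (if j = i + 1 ∨ j = i - 1 then f (Sum.inl j) else 0) =
      (if j = i + 1 then f (Sum.inl j) else 0) + if j = i - 1 then f (Sum.inl j) else 0 := by
    intro j
    grind
  simp [wt, Set.indicator_apply, sunGraph_adj_inl_inl, sunGraph_adj_inl_inr, hsplit,
    Finset.sum_add_distrib]

theorem sum_wt_sunGraph (m : ℕ) (f : Fin (m + 3) ⊕ Fin (m + 3) → ℕ) :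
    ∑ x, wt (sunGraph (m + 3)) f x = 2 * ∑ i, f (Sum.inl i) + ∑ x, f x := by
  have h1 : ∑ i : Fin (m + 3), f (Sum.inl (i + 1)) = ∑ i, f (Sum.inl i) :=
    Equiv.sum_comp (Equiv.addRight 1) fun i => f (Sum.inl i)
  have h2 : ∑ i : Fin (m + 3), f (Sum.inl (i - 1)) = ∑ i, f (Sum.inl i) :=
    Equiv.sum_comp (Equiv.subRight 1) fun i => f (Sum.inl i)
  simp only [Fintype.sum_sum_type, wt_sunGraph_inl, wt_sunGraph_inr, Finset.sum_add_distrib,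
    h1, h2]
  ring

/-- No sun `Sₙ` (`n ≥ 3`) admits an `(a,d)`-distance antimagic labeling. -/
theorem sun_not_ADDistanceAntimagic (n : ℕ) (hn : 3 ≤ n) (a d : ℤ) (hd : 0 ≤ d) :
    ¬ ADDistanceAntimagic (sunGraph n) a d := by
  obtain ⟨m, rfl⟩ := Nat.exists_eq_add_of_le' hn
  rintro ⟨f, hf⟩
  set g : Fin (m + 3) ⊕ Fin (m + 3) → ℕ := fun y => (f y : ℕ) + 1 with hg
  have hcard : Fintype.card (Fin (m + 3) ⊕ Fin (m + 3)) = 2 * (m + 3) := by simp; ring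
  have hmem : ∀ x, ∃ k : ℕ, a + k * d = (wt (sunGraph (m + 3)) g x : ℤ) := by
    intro x
    have hx := Finset.mem_image_of_mem (fun x => (wt (sunGraph (m + 3)) g x : ℤ))
      (Finset.mem_univ x)
    rw [hf] at hx
    obtain ⟨k, -, hk⟩ := Finset.mem_image.mp hx
    exact ⟨k, hk⟩
  choose k hk using fun i => hmem (Sum.inr i)
  simp only [wt_sunGraph_inr] at hk
  have hk_inj : Function.Injective k := by
    intro i j hij
    have h : (g (Sum.inl i) : ℤ) = g (Sum.inl j) := by rw [← hk, ← hk, hij]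
    have h' : f (Sum.inl i) = f (Sum.inl j) := by
      apply Fin.ext
      simp only [hg] at h
      omega
    exact Sum.inl_injective (f.injective h')
  have hd_pos : 0 < d := by
    refine lt_of_le_of_ne hd fun h0 => ?_
    have h : (g (Sum.inl 0) : ℤ) = g (Sum.inl 1) := by rw [← hk, ← hk, ← h0]; simp
    have h' : f (Sum.inl 0) = f (Sum.inl 1) := by
      apply Fin.ext
      simp only [hg] at h
      omega
    simpa using f.injective h'
  have hprog : Function.Injective fun i : ℕ => a + (i : ℤ) * d := by
    intro i j hij
    simpa [hd_pos.ne'] using hij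
  have hwt_inj : Function.Injective fun x => (wt (sunGraph (m + 3)) g x : ℤ) := by
    rw [← Set.injOn_univ, ← Finset.coe_univ, ← Finset.card_image_iff, hf,
      Finset.card_image_of_injective _ hprog, Finset.card_range, Finset.card_univ]
  have hsum : ∑ x, (wt (sunGraph (m + 3)) g x : ℤ) =
      ∑ i ∈ Finset.range (2 * (m + 3)), (a + (i : ℤ) * d) := by
    have h := congrArg (fun s : Finset ℤ => ∑ z ∈ s, z) hf
    rwa [Finset.sum_image hwt_inj.injOn, Finset.sum_image hprog.injOn, hcard] at h
  have hgauss : (∑ i ∈ Finset.range (2 * (m + 3)), (i : ℤ)) = (m + 3) * (2 * m + 5) := by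
    have h := Finset.sum_range_id_mul_two (2 * (m + 3))
    have h' : (2 * (m + 3)) - 1 = 2 * m + 5 := by omega
    rw [h'] at h
    zify at h
    linarith
  have hlabels : (∑ x, (g x : ℤ)) = ∑ i ∈ Finset.range (2 * (m + 3)), ((i : ℤ) + 1) := by
    rw [← hcard, ← Fin.sum_univ_eq_sum_range (fun i : ℕ => (i : ℤ) + 1)]
    rw [← Equiv.sum_comp f]
    simp [hg]
  have hcycle : (∑ i, (g (Sum.inl i) : ℤ)) = (m + 3) * a + (∑ i, (k i : ℤ)) * d := by
    simp [← hk, Finset.sum_add_distrib, Finset.sum_mul]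
  have hk_sum : ((m : ℤ) + 3) * (m + 2) ≤ 2 * ∑ i, (k i : ℤ) := by
    have h := card_mul_pred_le_two_mul_sum (Finset.univ.image k)
    rw [Finset.card_image_of_injective _ hk_inj, Finset.sum_image hk_inj.injOn] at h
    simp only [Finset.card_univ, Fintype.card_fin] at h
    exact_mod_cast h
  have htotal := sum_wt_sunGraph m g
  zify at htotal
  rw [hsum, hlabels, hcycle] at htotal
  simp only [Finset.sum_add_distrib, ← Finset.sum_mul, hgauss, Finset.sum_const,
    Finset.card_range, nsmul_eq_mul] at htotal
  push_cast at htotal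
  have hd_ge : 3 ≤ d := by
    by_contra! hlt
    interval_cases d <;> nlinarith
  obtain ⟨i, hi⟩ : ∃ i, m + 2 ≤ k i := by
    by_contra! hlt
    have h := Finset.card_le_card (s := Finset.univ.image k) (t := Finset.range (m + 2))
      (by intro x hx; obtain ⟨i, -, rfl⟩ := Finset.mem_image.mp hx; simpa using hlt i)
    rw [Finset.card_image_of_injective _ hk_inj] at h
    simp at h
  have ha : 1 ≤ a := by
    have h0 : a ∈ Finset.univ.image fun x => (wt (sunGraph (m + 3)) g x : ℤ) := by
      rw [hf]
      exact Finset.mem_image.mpr ⟨0, by simp, by simp⟩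
    obtain ⟨x, -, hx⟩ := Finset.mem_image.mp h0
    rw [← hx]
    rcases x with x | x
    · rw [wt_sunGraph_inl]; simp only [hg]; push_cast; omega
    · rw [wt_sunGraph_inr]; simp only [hg]; push_cast; omega
  have hle : (g (Sum.inl i) : ℤ) ≤ 2 * (m + 3) := by
    have h := (f (Sum.inl i)).isLt
    simp only [hg]
    omega
  rw [← hk] at hle
  zify at hi
  nlinarith [mul_le_mul hi hd_ge (by norm_num) (by positivity)]
end

section
/- For every n \geq 3, the prism C_n \times K_2 admits an (a,d)-distance antimagic labeling for some integers a and d \geq 0 if and only if d = 1. -/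
/-- The prism `Cₙ × K₂`: two disjoint copies of the cycle `Cₙ` (indexed by a
`Bool`), with the two copies of each vertex joined by an edge. -/
def prismGraph (n : ℕ) : SimpleGraph (Fin n × Bool) :=
  SimpleGraph.fromRel fun p q =>
    (p.2 = q.2 ∧ ((p.1 : ℕ) + 1) % n = (q.1 : ℕ)) ∨ (p.1 = q.1 ∧ p.2 ≠ q.2)

theorem prismGraph_adj_iff {n : ℕ} [NeZero n] (hn : 3 ≤ n) (i : Fin n) (b : Bool)
    (q : Fin n × Bool) :
    (prismGraph n).Adj (i, b) q ↔ q = (i + 1, b) ∨ q = (i - 1, b) ∨ q = (i, !b) := by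
  obtain ⟨j, c⟩ := q
  have hi := i.isLt
  have hj := j.isLt
  have h1 : ((1 : Fin n) : ℕ) = 1 := by
    rw [Fin.val_one', Nat.mod_eq_of_lt (by omega)]
  have hs : j = i + 1 ↔ ((i : ℕ) + 1) % n = (j : ℕ) := by
    rw [Fin.ext_iff, Fin.val_add, h1, eq_comm]
  have hp : j = i - 1 ↔ ((j : ℕ) + 1) % n = (i : ℕ) := by
    rw [eq_sub_iff_add_eq, Fin.ext_iff, Fin.val_add, h1]
  have hne : i + 1 ≠ i := fun h => by
    have h' := congrArg Fin.val (add_eq_left.mp h)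
    rw [h1] at h'
    simp at h'
  have hne' : i - 1 ≠ i := fun h => by
    have h' := congrArg Fin.val (sub_eq_self.mp h)
    rw [h1] at h'
    simp at h'
  simp only [prismGraph, SimpleGraph.fromRel_adj, Prod.mk.injEq, ← hs, ← hp]
  constructor
  · rintro ⟨-, (⟨h, h'⟩ | ⟨h, h'⟩) | (⟨h, h'⟩ | ⟨h, h'⟩)⟩
    · exact Or.inl ⟨h', h.symm⟩
    · exact Or.inr (Or.inr ⟨h.symm, by cases b <;> cases c <;> simp_all⟩)
    · exact Or.inr (Or.inl ⟨h', h⟩)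
    · exact Or.inr (Or.inr ⟨h, by cases b <;> cases c <;> simp_all⟩)
  · rintro (⟨rfl, rfl⟩ | ⟨rfl, rfl⟩ | ⟨rfl, rfl⟩)
    · exact ⟨fun h => hne (congrArg Prod.fst h).symm, Or.inl (Or.inl ⟨rfl, rfl⟩)⟩
    · exact ⟨fun h => hne' (congrArg Prod.fst h).symm, Or.inr (Or.inl ⟨rfl, rfl⟩)⟩
    · exact ⟨by simp, Or.inl (Or.inr ⟨rfl, by simp⟩)⟩

theorem wt_prismGraph {n : ℕ} [NeZero n] (hn : 3 ≤ n) (f : Fin n × Bool → ℕ) (i : Fin n)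
    (b : Bool) : wt (prismGraph n) f (i, b) = f (i + 1, b) + f (i - 1, b) + f (i, !b) := by
  classical
  have hset : (prismGraph n).neighborSet (i, b) =
      (({(i + 1, b), (i - 1, b), (i, !b)} : Finset (Fin n × Bool)) : Set _) := by
    ext q
    simp [prismGraph_adj_iff hn]
  have hne : i + 1 ≠ i - 1 := fun h => by
    have h1 : ((1 : Fin n) : ℕ) = 1 := by
      rw [Fin.val_one', Nat.mod_eq_of_lt (by omega)]
    have h2 : i + 1 + 1 = i := by rw [h, sub_add_cancel]
    rw [add_assoc, add_eq_left, Fin.ext_iff, Fin.val_add, h1,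
      Nat.mod_eq_of_lt (by omega)] at h2
    simp at h2
  rw [wt, hset, Finset.sum_indicator_subset _ (Finset.subset_univ _),
    Finset.sum_insert (by simp [hne]), Finset.sum_insert (by simp), Finset.sum_singleton,
    add_assoc]

theorem sum_wt_prismGraph {n : ℕ} (hn : 3 ≤ n) (f : Fin n × Bool → ℕ) :
    ∑ p, wt (prismGraph n) f p = 3 * ∑ p, f p := by
  have : NeZero n := ⟨by omega⟩
  have hs : ∀ b, ∑ i : Fin n, f (i + 1, b) = ∑ i, f (i, b) := fun b =>
    Equiv.sum_comp (Equiv.addRight (1 : Fin n)) fun i => f (i, b)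
  have hp : ∀ b, ∑ i : Fin n, f (i - 1, b) = ∑ i, f (i, b) := fun b =>
    Equiv.sum_comp (Equiv.subRight (1 : Fin n)) fun i => f (i, b)
  simp only [Fintype.sum_prod_type_right, wt_prismGraph hn, Finset.sum_add_distrib, hs, hp,
    Fintype.sum_bool, Bool.not_true, Bool.not_false]
  ring

/-- The sum of the weights is determined by `a` and `d`, also when `d = 0`. -/
theorem sum_eq_of_image_eq_arith {α : Type*} [Fintype α] (w : α → ℤ) (a d : ℤ)
    (h : Finset.univ.image w =
      (Finset.range (Fintype.card α)).image fun i : ℕ => a + (i : ℤ) * d) :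
    ∑ x, w x = ∑ i ∈ Finset.range (Fintype.card α), (a + (i : ℤ) * d) := by
  classical
  rcases eq_or_ne d 0 with rfl | hd
  · have hw : ∀ x, w x = a := fun x => by
      have hx : w x ∈ Finset.univ.image w := Finset.mem_image_of_mem _ (Finset.mem_univ x)
      rw [h, Finset.mem_image] at hx
      obtain ⟨i, -, hi⟩ := hx
      simpa using hi.symm
    simp [hw]
  · have hinj : Function.Injective fun i : ℕ => a + (i : ℤ) * d := fun i j hij => by
      simpa [hd] using hij
    have hw : Set.InjOn w (Finset.univ : Finset α) := by
      rw [← Finset.card_image_iff, h, Finset.card_image_of_injective _ hinj,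
        Finset.card_range, Finset.card_univ]
    rw [← Finset.sum_image (f := fun z : ℤ => z) hw, h,
      Finset.sum_image hinj.injOn]

theorem ADDistanceAntimagic.eq_one {n : ℕ} (hn : 3 ≤ n) {a d : ℤ} (hd : 0 ≤ d)
    (h : ADDistanceAntimagic (prismGraph n) a d) : d = 1 := by
  obtain ⟨f, hf⟩ := h
  have : NeZero n := ⟨by omega⟩
  have hcard : Fintype.card (Fin n × Bool) = 2 * n := by simp [mul_comm]
  have ha : 4 ≤ a := by
    have hmem : a ∈ (Finset.range (Fintype.card (Fin n × Bool))).image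
        fun i : ℕ => a + (i : ℤ) * d :=
      Finset.mem_image.mpr ⟨0, Finset.mem_range.mpr (by omega), by simp⟩
    rw [← hf, Finset.mem_image] at hmem
    obtain ⟨⟨i, b⟩, -, hp⟩ := hmem
    rw [wt_prismGraph hn] at hp
    have hne : (f (i + 1, b) : ℕ) ≠ f (i, !b) := fun h => by
      have := f.injective (Fin.ext h)
      simp at this
    omega
  have hsum := sum_eq_of_image_eq_arith _ a d hf
  have hlabels : ∑ p, ((f p : ℕ) + 1) = ∑ i ∈ Finset.range (2 * n), (i + 1) := by
    rw [Equiv.sum_comp f fun i => (i : ℕ) + 1, Fin.sum_univ_eq_sum_range (fun i => i + 1), hcard]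
  have hgauss : ∀ m : ℕ, ∑ i ∈ Finset.range (2 * m), (i : ℤ) = m * (2 * m - 1) := fun m => by
    induction m with
    | zero => simp
    | succ k ih =>
      rw [mul_add, mul_one, Finset.sum_range_succ, Finset.sum_range_succ, ih]
      push_cast
      ring
  rw [← Nat.cast_sum, sum_wt_prismGraph hn, hlabels, hcard] at hsum
  push_cast at hsum
  simp only [Finset.sum_add_distrib, ← Finset.sum_mul, hgauss, Finset.sum_const,
    Finset.card_range, nsmul_eq_mul] at hsum
  have hn0 : (n : ℤ) ≠ 0 := by exact_mod_cast NeZero.ne n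
  have key : 3 * (2 * (n : ℤ) + 1) = 2 * a + (2 * n - 1) * d :=
    mul_left_cancel₀ hn0 (by push_cast at hsum; linarith)
  have hn' : (3 : ℤ) ≤ n := by exact_mod_cast hn
  have hd3 : d < 3 := by nlinarith
  interval_cases d <;> omega

/-- A labeling by `{0, …, 2n - 1}`, shifted by one in the weights, whose weights are distinct
and lie in `[2n + 2, 4n + 1]` is `(2n + 2, 1)`-distance antimagic. -/
theorem ADDistanceAntimagic.of_injective {n : ℕ} [NeZero n] (hn : 3 ≤ n)
    (g w : Fin n × Bool → ℕ) (hg : Function.Injective g) (hlt : ∀ p, g p < 2 * n)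
    (hw : ∀ i b, g (i + 1, b) + g (i - 1, b) + g (i, !b) + 3 = w (i, b))
    (hinj : Function.Injective w) (hmem : ∀ p, 2 * n + 2 ≤ w p ∧ w p < 4 * n + 2) :
    ADDistanceAntimagic (prismGraph n) (2 * n + 2) 1 := by
  have hcard : Fintype.card (Fin n × Bool) = 2 * n := by simp [mul_comm]
  refine ⟨Equiv.ofBijective (fun p => ⟨g p, hcard ▸ hlt p⟩)
    ((Fintype.bijective_iff_injective_and_card _).mpr
      ⟨fun p q h => hg (congrArg Fin.val h), by simp⟩), ?_⟩
  have hwt : ∀ p, wt (prismGraph n) (fun y => g y + 1) p = w p := by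
    rintro ⟨i, b⟩
    rw [wt_prismGraph hn, ← hw]
    ring
  simp only [Equiv.ofBijective_apply, hwt]
  apply Finset.eq_of_subset_of_card_le
  · intro z hz
    obtain ⟨p, -, rfl⟩ := Finset.mem_image.mp hz
    have := hmem p
    exact Finset.mem_image.mpr ⟨w p - (2 * n + 2), Finset.mem_range.mpr (by omega), by omega⟩
  · have hinj' : Function.Injective fun p => (w p : ℤ) := Nat.cast_injective.comp hinj
    rw [Finset.card_image_of_injective _ hinj', Finset.card_univ]
    exact Finset.card_image_le.trans (by simp)

/-- The labels, minus one, of the first cycle of a prism with `n ≥ 8`; the labels of the two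
ends of a rung add up to `2n + 1`. -/
def prismLabel (n i : ℕ) : ℕ :=
  if i = 0 then 2 * n - 2 else if i = 1 then 2 * n - 1 else if i = 2 then 2 * n - 3
  else if i = 3 then n - 2 else if i = 4 then n - 1 else if i = 5 then n + 2 else i - 3

/-- The weights of the first cycle under `prismLabel`. -/
def prismWeight (n i : ℕ) : ℕ :=
  if i = 0 then 3 * n - 1 else if i = 1 then 4 * n - 2 else if i = 2 then 3 * n + 2
  else if i = 3 then 4 * n else if i = 4 then 3 * n + 3 else if i = 5 then 2 * n + 2
  else if i = 6 then 3 * n + 5 else if i = n - 1 then 4 * n - 1 else 2 * n + i - 1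

theorem prismLabel_le {n i : ℕ} (hn : 8 ≤ n) (hi : i < n) : prismLabel n i ≤ 2 * n - 1 := by
  unfold prismLabel
  split_ifs <;> omega

theorem prismLabel_add_ne {n i j : ℕ} (hn : 8 ≤ n) (hi : i < n) (hj : j < n) :
    prismLabel n i + prismLabel n j ≠ 2 * n - 1 := by
  unfold prismLabel
  split_ifs <;> omega

theorem prismLabel_injOn {n i j : ℕ} (hn : 8 ≤ n) (hi : i < n) (hj : j < n) :
    prismLabel n i = prismLabel n j → i = j := by
  unfold prismLabel
  split_ifs <;> omega

theorem prismWeight_mem {n i : ℕ} (hn : 8 ≤ n) (hi : i < n) :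
    2 * n + 2 ≤ prismWeight n i ∧ prismWeight n i < 4 * n + 2 := by
  unfold prismWeight
  split_ifs <;> omega

set_option maxHeartbeats 1000000 in
theorem prismWeight_add_ne {n i j : ℕ} (hn : 8 ≤ n) (hi : i < n) (hj : j < n) :
    prismWeight n i + prismWeight n j ≠ 6 * n + 3 := by
  unfold prismWeight
  split_ifs <;> omega

set_option maxHeartbeats 1000000 in
theorem prismWeight_injOn {n i j : ℕ} (hn : 8 ≤ n) (hi : i < n) (hj : j < n) :
    prismWeight n i = prismWeight n j → i = j := by
  unfold prismWeight
  split_ifs <;> omega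

theorem prismLabel_add_prismLabel {n k s p : ℕ} (hn : 8 ≤ n) (hk : k < n)
    (hs : s = if k = n - 1 then 0 else k + 1) (hp : p = if k = 0 then n - 1 else k - 1) :
    prismLabel n s + prismLabel n p + (2 * n - 1 - prismLabel n k) + 3 = prismWeight n k := by
  have hcases : k = 0 ∨ k = 1 ∨ k = 2 ∨ k = 3 ∨ k = 4 ∨ k = 5 ∨ k = 6 ∨ k = n - 1 ∨
      (7 ≤ k ∧ k < n - 1) := by omega
  rcases hcases with h | h | h | h | h | h | h | h | h <;>
    grind (splits := 40) [prismLabel, prismWeight]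

theorem injective_complement {n : ℕ} (u : ℕ → ℕ) (c : ℕ) (hc : ∀ i < n, u i ≤ c)
    (hne : ∀ i < n, ∀ j < n, u i + u j ≠ c) (hinj : ∀ i < n, ∀ j < n, u i = u j → i = j) :
    Function.Injective fun p : Fin n × Bool => if p.2 then c - u p.1 else u p.1 := by
  rintro ⟨i, b⟩ ⟨j, b'⟩ h
  have hi := hc i i.isLt
  have hj := hc j j.isLt
  have hij := hne i i.isLt j j.isLt
  have hij' := hinj i i.isLt j j.isLt
  cases b <;> cases b' <;> simp at h ⊢ <;> omega

theorem aDDistanceAntimagic_prismGraph_of_eight_le {n : ℕ} (hn : 8 ≤ n) :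
    ADDistanceAntimagic (prismGraph n) (2 * n + 2) 1 := by
  have : NeZero n := ⟨by omega⟩
  refine ADDistanceAntimagic.of_injective (by omega)
    (fun p => if p.2 then 2 * n - 1 - prismLabel n p.1 else prismLabel n p.1)
    (fun p => if p.2 then 6 * n + 3 - prismWeight n p.1 else prismWeight n p.1)
    (injective_complement _ _ ?_ ?_ ?_) ?_ ?_ (injective_complement _ _ ?_ ?_ ?_) ?_
  · exact fun i hi => prismLabel_le hn hi
  · exact fun i hi j hj => prismLabel_add_ne hn hi hj
  · exact fun i hi j hj => prismLabel_injOn hn hi hj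
  · rintro ⟨i, b⟩
    have := prismLabel_le hn i.isLt
    dsimp only
    split_ifs <;> omega
  · intro i b
    have hi := i.isLt
    have h1 : ((1 : Fin n) : ℕ) = 1 := by
      rw [Fin.val_one', Nat.mod_eq_of_lt (by omega)]
    have hs : (i + 1).val = if i.val = n - 1 then 0 else i.val + 1 := by
      rw [Fin.val_add, h1]
      split_ifs with h
      · rw [h, Nat.sub_add_cancel (by omega), Nat.mod_self]
      · exact Nat.mod_eq_of_lt (by omega)
    have hp : (i - 1).val = if i.val = 0 then n - 1 else i.val - 1 := by
      rw [Fin.val_sub, h1]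
      split_ifs with h
      · rw [h, Nat.add_zero, Nat.mod_eq_of_lt (by omega)]
      · rw [show n - 1 + i.val = i.val - 1 + n by omega, Nat.add_mod_right,
          Nat.mod_eq_of_lt (by omega)]
    have hw := prismLabel_add_prismLabel hn hi hs hp
    have hl := prismLabel_le hn hi
    have hl' := prismLabel_le hn (i + 1).isLt
    have hl'' := prismLabel_le hn (i - 1).isLt
    cases b <;> simp <;> omega
  · exact fun i hi => (prismWeight_mem hn hi).2.le.trans (by omega)
  · exact fun i hi j hj => prismWeight_add_ne hn hi hj
  · exact fun i hi j hj => prismWeight_injOn hn hi hj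
  · rintro ⟨i, b⟩
    have := prismWeight_mem hn i.isLt
    dsimp only
    split_ifs <;> omega

theorem ADDistanceAntimagic.of_rows {n : ℕ} [NeZero n] (hn : 3 ≤ n) (u v : Fin n → ℕ) :
    let g : Fin n × Bool → ℕ := fun p => if p.2 then v p.1 else u p.1
    let w : Fin n × Bool → ℕ := fun p => g (p.1 + 1, p.2) + g (p.1 - 1, p.2) + g (p.1, !p.2) + 3
    Function.Injective g → (∀ p, g p < 2 * n) → Function.Injective w →
      (∀ p, 2 * n + 2 ≤ w p ∧ w p < 4 * n + 2) →
      ADDistanceAntimagic (prismGraph n) (2 * n + 2) 1 :=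
  fun hg hlt hinj hmem => of_injective hn _ _ hg hlt (fun _ _ => rfl) hinj hmem

theorem aDDistanceAntimagic_prismGraph_of_lt_eight {n : ℕ} (hn : 3 ≤ n) (hn' : n < 8) :
    ADDistanceAntimagic (prismGraph n) (2 * n + 2) 1 := by
  interval_cases n
  · exact .of_rows hn ![0, 2, 5] ![1, 4, 3] (by decide) (by decide) (by decide) (by decide)
  · exact .of_rows hn ![0, 2, 4, 6] ![1, 3, 5, 7] (by decide) (by decide) (by decide) (by decide)
  · exact .of_rows hn ![0, 2, 3, 4, 7] ![1, 8, 9, 6, 5]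
      (by decide) (by decide) (by decide) (by decide)
  · exact .of_rows hn ![0, 2, 8, 4, 6, 10] ![1, 3, 9, 5, 7, 11]
      (by decide) (by decide) (by decide) (by decide)
  · exact .of_rows hn ![0, 2, 10, 8, 6, 4, 12] ![1, 3, 11, 9, 7, 5, 13]
      (by decide) (by decide) (by decide) (by decide)

/-- For `n ≥ 3`, the prism `Cₙ × K₂` admits an `(a,d)`-distance antimagic labeling
for some `a` if and only if `d = 1`. -/
theorem prism_ADDistanceAntimagic_iff (n : ℕ) (hn : 3 ≤ n) (d : ℤ) (hd : 0 ≤ d) :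
    (∃ a : ℤ, ADDistanceAntimagic (prismGraph n) a d) ↔ d = 1 := by
  constructor
  · rintro ⟨a, h⟩
    exact h.eq_one hn hd
  · rintro rfl
    refine ⟨2 * n + 2, ?_⟩
    rcases lt_or_ge n 8 with h | h
    · exact aDDistanceAntimagic_prismGraph_of_lt_eight hn h
    · exact aDDistanceAntimagic_prismGraph_of_eight_le h
end

section
/- For n \geq 3, the wheel W_n admits an (a,d)-distance antimagic labeling for some integers a and d \geq 0 if and only if 3 \leq n \leq 5. -/
/-- The wheel `Wₙ`: a cycle on vertices `some 0, …, some (n-1)` together with a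
center vertex `none` adjacent to all of them. -/
def wheelGraph (n : ℕ) : SimpleGraph (Option (Fin n)) :=
  SimpleGraph.fromRel fun x y =>
    match x, y with
    | none, some _ => True
    | some x, some y => ((x : ℕ) + 1) % n = (y : ℕ)
    | _, _ => False

theorem wheelGraph_adj_none_some (n : ℕ) (i : Fin n) : (wheelGraph n).Adj none (some i) := by
  simp [wheelGraph]

theorem wheelGraph_adj_some_some {n : ℕ} [NeZero n] (hn : 2 ≤ n) (i j : Fin n) :
    (wheelGraph n).Adj (some i) (some j) ↔ j = i + 1 ∨ j = i - 1 := by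
  have succ_iff (x y : Fin n) : ((x : ℕ) + 1) % n = y ↔ y = x + 1 := by
    rw [Fin.ext_iff, Fin.val_add, Fin.val_one', Nat.add_mod_mod, eq_comm]
  have one_ne : (1 : Fin n) ≠ 0 := by
    rw [Ne, Fin.ext_iff, Fin.val_one', Fin.val_zero, Nat.mod_eq_of_lt hn]
    exact one_ne_zero
  simp only [wheelGraph, SimpleGraph.fromRel_adj, succ_iff, ne_eq, Option.some.injEq]
  constructor
  · rintro ⟨-, h | h⟩
    · exact Or.inl h
    · exact Or.inr (by rw [h, add_sub_cancel_right])
  · rintro (rfl | rfl)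
    · exact ⟨by simpa using one_ne, Or.inl rfl⟩
    · exact ⟨fun h => one_ne (sub_eq_self.1 h.symm), Or.inr (by rw [sub_add_cancel])⟩

theorem wt_wheelGraph_none (n : ℕ) (f : Option (Fin n) → ℕ) :
    wt (wheelGraph n) f none = ∑ i, f (some i) := by
  simp [wt, Fintype.sum_option, Set.indicator, wheelGraph_adj_none_some]

theorem Fin.add_one_ne_sub_one {n : ℕ} [NeZero n] (hn : 3 ≤ n) (i : Fin n) : i + 1 ≠ i - 1 := by
  intro h
  have two_eq : (1 : Fin n) + 1 = 0 := by
    have := congrArg (fun k => k + 1 - i) h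
    simpa [add_assoc] using this
  have := congrArg Fin.val two_eq
  rw [Fin.val_add, Fin.val_one', Nat.mod_eq_of_lt (by omega : 1 < n), Nat.mod_eq_of_lt hn] at this
  simp at this

theorem wt_wheelGraph_some {n : ℕ} [NeZero n] (hn : 3 ≤ n) (f : Option (Fin n) → ℕ) (i : Fin n) :
    wt (wheelGraph n) f (some i) = f none + f (some (i + 1)) + f (some (i - 1)) := by
  classical
  have hsum : ∀ j, (((wheelGraph n).neighborSet (some i)).indicator f (some j)) =
      if j ∈ ({i + 1, i - 1} : Finset (Fin n)) then f (some j) else 0 := by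
    intro j
    simp [Set.indicator, wheelGraph_adj_some_some (by omega : 2 ≤ n)]
  rw [wt, Fintype.sum_option, Fintype.sum_congr _ _ hsum, Finset.sum_ite_mem, Finset.univ_inter,
    Finset.sum_pair (Fin.add_one_ne_sub_one hn i), add_assoc]
  simp [Set.indicator, (wheelGraph_adj_none_some n i).symm]

/-- A labeling of the wheel by `Fin (n + 1)` whose weights form an arithmetic progression
witnesses distance antimagicness. -/
theorem ADDistanceAntimagic.of_equiv {n : ℕ} {a d : ℤ} (e : Option (Fin n) ≃ Fin (n + 1))
    (h : (Finset.univ.image fun x => (wt (wheelGraph n) (fun y => (e y : ℕ) + 1) x : ℤ)) =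
      (Finset.range (n + 1)).image fun i : ℕ => a + (i : ℤ) * d) :
    ADDistanceAntimagic (wheelGraph n) a d := by
  have hcard : Fintype.card (Option (Fin n)) = n + 1 := by simp
  refine ⟨e.trans (finCongr hcard.symm), ?_⟩
  simpa using h

theorem ADDistanceAntimagic.wheelGraph_three : ADDistanceAntimagic (wheelGraph 3) 6 1 := by
  refine .of_equiv finSuccEquivLast.symm ?_
  have weights : (fun x => (wt (wheelGraph 3)
      (fun y => ((finSuccEquivLast.symm y : Fin 4) : ℕ) + 1) x : ℤ)) =
      fun x => x.elim 6 ![9, 8, 7] := by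
    funext x
    cases x with
    | none => simp [wt_wheelGraph_none, Fin.sum_univ_succ]
    | some i => rw [wt_wheelGraph_some le_rfl]; fin_cases i <;> rfl
  rw [weights]
  decide

theorem ADDistanceAntimagic.wheelGraph_four : ADDistanceAntimagic (wheelGraph 4) 10 0 := by
  refine .of_equiv (finSuccEquivLast.symm.trans (Equiv.swap 2 3)) ?_
  have weights : (fun x => (wt (wheelGraph 4)
      (fun y => ((finSuccEquivLast.symm.trans (Equiv.swap 2 3) y : Fin 5) : ℕ) + 1) x : ℤ)) =
      fun _ => 10 := by
    funext x
    cases x with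
    | none => rw [wt_wheelGraph_none]; rfl
    | some i => rw [wt_wheelGraph_some (by norm_num)]; fin_cases i <;> rfl
  rw [weights]
  decide

theorem ADDistanceAntimagic.wheelGraph_five : ADDistanceAntimagic (wheelGraph 5) 10 1 := by
  refine .of_equiv finSuccEquivLast.symm ?_
  have weights : (fun x => (wt (wheelGraph 5)
      (fun y => ((finSuccEquivLast.symm y : Fin 6) : ℕ) + 1) x : ℤ)) =
      fun x => x.elim 15 ![13, 10, 12, 14, 11] := by
    funext x
    cases x with
    | none => rw [wt_wheelGraph_none]; rfl
    | some i => rw [wt_wheelGraph_some (by norm_num)]; fin_cases i <;> rfl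
  rw [weights]
  decide

/-- A rim weight is a sum of three distinct labels from `{1, …, n + 1}`. -/
theorem wt_wheelGraph_some_mem_Icc {n m : ℕ} (hn : 3 ≤ n) (hm : m = n + 1)
    (f : Option (Fin n) ≃ Fin m) (i : Fin n) :
    wt (wheelGraph n) (fun y => (f y : ℕ) + 1) (some i) ∈ Set.Icc 6 (3 * n) := by
  have : NeZero n := ⟨by omega⟩
  rw [wt_wheelGraph_some hn]
  have h₁ : (f none : ℕ) ≠ f (some (i + 1)) := by simp [Fin.val_inj]
  have h₂ : (f none : ℕ) ≠ f (some (i - 1)) := by simp [Fin.val_inj]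
  have h₃ : (f (some (i + 1)) : ℕ) ≠ f (some (i - 1)) := by
    simpa [Fin.val_inj] using Fin.add_one_ne_sub_one hn i
  constructor <;> omega

theorem two_mul_wt_wheelGraph_none {n m : ℕ} (hm : m = n + 1) (f : Option (Fin n) ≃ Fin m) :
    2 * (wt (wheelGraph n) (fun y => (f y : ℕ) + 1) none + f none + 1) = (n + 1) * (n + 2) := by
  have total : ∑ y, ((f y : ℕ) + 1) = ∑ k ∈ Finset.range (n + 1), (k + 1) := by
    rw [f.sum_comp (fun k : Fin m => (k : ℕ) + 1), Fin.sum_univ_eq_sum_range (fun k => k + 1), hm]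
  have gauss := Finset.sum_range_id_mul_two (n + 2)
  rw [Finset.sum_range_succ', add_zero, ← total, Fintype.sum_option] at gauss
  rw [wt_wheelGraph_none]
  rw [show n + 2 - 1 = n + 1 by omega] at gauss
  linarith

theorem ADDistanceAntimagic.le_five_of_wheelGraph {n : ℕ} (hn : 3 ≤ n) {a d : ℤ} (hd : 0 ≤ d)
    (h : ADDistanceAntimagic (wheelGraph n) a d) : n ≤ 5 := by
  obtain ⟨f, hf⟩ := h
  have hcard : Fintype.card (Option (Fin n)) = n + 1 := by simp
  have center := two_mul_wt_wheelGraph_none hcard f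
  have rim := wt_wheelGraph_some_mem_Icc hn hcard f
  have label := (f none).isLt
  set w := wt (wheelGraph n) (fun y => (f y : ℕ) + 1)
  have mem (x) : ∃ k : ℕ, k ≤ n ∧ (w x : ℤ) = a + k * d := by
    have := hf ▸ Finset.mem_image_of_mem (fun x => (w x : ℤ)) (Finset.mem_univ x)
    obtain ⟨k, hk, hk'⟩ := Finset.mem_image.1 this
    exact ⟨k, by simpa [Nat.lt_succ_iff] using hk, hk'.symm⟩
  have attained (k : ℕ) (hk : k ≤ n) : ∃ x, (w x : ℤ) = a + k * d := by
    have : a + (k : ℤ) * d ∈ (Finset.range (Fintype.card (Option (Fin n)))).image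
        fun i : ℕ => a + (i : ℤ) * d :=
      Finset.mem_image_of_mem (fun i : ℕ => a + (i : ℤ) * d) (by simpa [Nat.lt_succ_iff] using hk)
    rw [← hf] at this
    simpa using this
  by_contra! hlt
  have center_ge : 3 * n + 3 ≤ w none := by nlinarith
  have six_le : 6 ≤ a := by
    obtain ⟨x, hx⟩ := attained 0 (Nat.zero_le n)
    have : 6 ≤ w x := by
      cases x with
      | none => omega
      | some i => exact (rim i).1
    push_cast at hx
    linarith
  have second_le : a + (n - 1) * d ≤ 3 * n := by
    obtain ⟨x, hx⟩ := attained (n - 1) (Nat.sub_le n 1)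
    obtain ⟨y, hy⟩ := attained n le_rfl
    rw [Nat.cast_sub (by omega), Nat.cast_one] at hx
    cases x with
    | some i => have := (rim i).2; lia
    | none =>
      cases y with
      | some i => have := (rim i).2; nlinarith
      | none =>
        have d_zero : d = 0 := by linarith
        obtain ⟨k, -, hk⟩ := mem (some ⟨0, by omega⟩)
        have := (rim ⟨0, by omega⟩).2
        subst d_zero
        lia
  have d_le : d ≤ 2 := by
    have : (6 : ℤ) ≤ n := by exact_mod_cast hlt
    nlinarith
  obtain ⟨k, hk, hk'⟩ := mem none
  have : (k : ℤ) * d ≤ n * d := mul_le_mul_of_nonneg_right (by exact_mod_cast hk) hd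
  have : (3 * n + 3 : ℤ) ≤ w none := by exact_mod_cast center_ge
  linarith

/-- For `n ≥ 3`, the wheel `Wₙ` admits an `(a,d)`-distance antimagic labeling for
some `a` and `d ≥ 0` if and only if `3 ≤ n ≤ 5`. -/
theorem wheel_ADDistanceAntimagic_iff (n : ℕ) (hn : 3 ≤ n) :
    (∃ a d : ℤ, 0 ≤ d ∧ ADDistanceAntimagic (wheelGraph n) a d) ↔ (3 ≤ n ∧ n ≤ 5) := by
  constructor
  · rintro ⟨a, d, hd, h⟩
    exact ⟨hn, h.le_five_of_wheelGraph hn hd⟩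
  · rintro ⟨-, hn'⟩
    interval_cases n
    · exact ⟨6, 1, zero_le_one, .wheelGraph_three⟩
    · exact ⟨10, 0, le_rfl, .wheelGraph_four⟩
    · exact ⟨10, 1, zero_le_one, .wheelGraph_five⟩
end

section
/- For n \geq 2, the fan F_n admits an (a,d)-distance antimagic labeling for some integers a and d \geq 0 if and only if n = 2 or n = 4. -/
/-- The fan `Fₙ`: a path on vertices `some 0, …, some (n-1)` together with a
center vertex `none` adjacent to all of them. -/
def fanGraph (n : ℕ) : SimpleGraph (Option (Fin n)) :=
  SimpleGraph.fromRel fun x y =>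
    match x, y with
    | none, some _ => True
    | some x, some y => (x : ℕ) + 1 = (y : ℕ)
    | _, _ => False

theorem wt_fanGraph_none {n : ℕ} (g : Option (Fin n) → ℕ) :
    wt (fanGraph n) g none = ∑ i, g (some i) := by
  simp [wt, Fintype.sum_option, fanGraph]

theorem wt_fanGraph_some {n : ℕ} (g : Option (Fin n) → ℕ) (i : Fin n) :
    wt (fanGraph n) g (some i) = g none
      + (if h : (i : ℕ) + 1 < n then g (some ⟨i + 1, h⟩) else 0)
      + (if 0 < (i : ℕ) then g (some ⟨i - 1, by omega⟩) else 0) := by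
  have split_adj : ∀ j : Fin n, ((fanGraph n).neighborSet (some i)).indicator g (some j) =
      (if (i : ℕ) + 1 = j then g (some j) else 0) +
      (if (j : ℕ) + 1 = i then g (some j) else 0) := by
    intro j
    classical
    simp only [Set.indicator_apply, fanGraph, SimpleGraph.mem_neighborSet,
      SimpleGraph.fromRel_adj, ne_eq, Option.some.injEq, Fin.ext_iff]
    split_ifs <;> omega
  have sum_succ : ∑ j : Fin n, (if (i : ℕ) + 1 = j then g (some j) else 0) =
      if h : (i : ℕ) + 1 < n then g (some ⟨i + 1, h⟩) else 0 := by
    split_ifs with h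
    · rw [Finset.sum_eq_single ⟨i + 1, h⟩]
      · simp
      · intro j _ hj
        rw [if_neg fun e => hj (Fin.ext e.symm)]
      · simp
    · exact Finset.sum_eq_zero fun j _ => if_neg (by omega)
  have sum_pred : ∑ j : Fin n, (if (j : ℕ) + 1 = i then g (some j) else 0) =
      if 0 < (i : ℕ) then g (some ⟨i - 1, by omega⟩) else 0 := by
    split_ifs with h
    · rw [Finset.sum_eq_single ⟨i - 1, by omega⟩]
      · rw [if_pos (by simp only; omega)]
      · intro j _ hj
        rw [if_neg fun e => hj (Fin.ext (by simp only; omega))]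
      · simp
    · exact Finset.sum_eq_zero fun j _ => if_neg (by omega)
  rw [wt, Fintype.sum_option, Finset.sum_congr rfl fun j _ => split_adj j,
    Finset.sum_add_distrib, sum_succ, sum_pred, add_assoc]
  congr 1
  simp [fanGraph]

theorem wt_fanGraph_some_bounds {n : ℕ} (hn : 2 ≤ n) {g : Option (Fin n) → ℕ}
    (hg : Function.Injective g) (hpos : ∀ x, 1 ≤ g x) (hle : ∀ x, g x ≤ n + 1) (i : Fin n) :
    g none + 1 ≤ wt (fanGraph n) g (some i) ∧
      wt (fanGraph n) g (some i) ≤ g none + (2 * n + 1) ∧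
      wt (fanGraph n) g (some i) ≤ 3 * n := by
  rw [wt_fanGraph_some]
  have ne_none : ∀ j, g (some j) ≠ g none := fun j => hg.ne (by simp)
  have hc := hle none
  split_ifs with h₁ h₂ h₂
  · have a₁ := hle (some ⟨i + 1, h₁⟩)
    have a₂ := hle (some ⟨i - 1, by omega⟩)
    have p₁ := hpos (some ⟨i + 1, h₁⟩)
    have c₁ := ne_none ⟨i + 1, h₁⟩
    have c₂ := ne_none ⟨i - 1, by omega⟩
    have c₃ : g (some ⟨i + 1, h₁⟩) ≠ g (some ⟨i - 1, by omega⟩) :=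
      hg.ne (by simp only [ne_eq, Option.some.injEq, Fin.mk.injEq]; omega)
    have := i.2
    omega
  · have a₁ := hle (some ⟨i + 1, h₁⟩)
    have p₁ := hpos (some ⟨i + 1, h₁⟩)
    have c₁ := ne_none ⟨i + 1, h₁⟩
    omega
  · have a₂ := hle (some ⟨i - 1, by omega⟩)
    have p₂ := hpos (some ⟨i - 1, by omega⟩)
    have c₂ := ne_none ⟨i - 1, by omega⟩
    omega
  · have := i.2
    omega

theorem two_mul_sum_add_one {α : Type*} [Fintype α] (f : α ≃ Fin (Fintype.card α)) :
    2 * ∑ x, ((f x : ℕ) + 1) = Fintype.card α * (Fintype.card α + 1) := by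
  rw [Equiv.sum_comp f fun k => (k : ℕ) + 1, Fin.sum_univ_eq_sum_range (fun k => k + 1),
    mul_comm]
  have := Finset.sum_range_id_mul_two (Fintype.card α + 1)
  rw [Finset.sum_range_succ'] at this
  simpa [mul_comm] using this

section Progression

variable {n : ℕ} {W : Option (Fin n) → ℤ} {a d : ℤ}

theorem progression_step_le (hn : 4 ≤ n) {m : ℤ} (hd : 0 ≤ d)
    (hsurj : ∀ k ≤ n, ∃ x, W x = a + k * d)
    (hlow : ∀ i, m ≤ W (some i)) (hupp : ∀ i, W (some i) ≤ m + 2 * n) : d ≤ 2 := by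
  by_contra! hd3
  have far : ∀ j k : ℕ, j + (n - 1) ≤ k → ∀ p q : Fin n,
      W (some p) = a + j * d → W (some q) = a + k * d → False := by
    intro j k hjk p q hp hq
    have := hlow p
    have := hupp q
    have hjk' : (j : ℤ) + (n - 1) ≤ k := by omega
    have hn' : (4 : ℤ) ≤ n := by exact_mod_cast hn
    nlinarith
  obtain ⟨x, hx⟩ := hsurj 0 (by omega)
  obtain ⟨y, hy⟩ := hsurj n le_rfl
  have hn' : (4 : ℤ) ≤ n := by exact_mod_cast hn
  rcases x with _ | p <;> rcases y with _ | q
  · rw [hx] at hy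
    push_cast at hy
    nlinarith
  · obtain ⟨z, hz⟩ := hsurj 1 (by omega)
    rcases z with _ | r
    · rw [hx] at hz
      push_cast at hz
      linarith
    · exact far 1 n (by omega) r q hz hy
  · obtain ⟨z, hz⟩ := hsurj (n - 1) (by omega)
    rcases z with _ | r
    · rw [hy, Nat.cast_sub (by omega)] at hz
      push_cast at hz
      linarith
    · exact far 0 (n - 1) (by omega) p r hx hz
  · exact far 0 n (by omega) p q hx hy

theorem progression_center_le (hn : 0 < n) {M : ℤ} (hd : 0 ≤ d)
    (hmem : ∀ x, ∃ k ≤ n, W x = a + k * d)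
    (hsurj : ∀ k ≤ n, ∃ x, W x = a + k * d)
    (hupp : ∀ i, W (some i) ≤ M) : W none ≤ M + d := by
  obtain ⟨k, hk, hW⟩ := hmem none
  obtain ⟨l, -, hl⟩ := hmem (some ⟨0, hn⟩)
  have h₀ := hupp ⟨0, hn⟩
  have hl₀ : (0 : ℤ) ≤ l * d := by positivity
  rcases k with _ | k
  · push_cast at hW
    linarith
  · obtain ⟨x, hx⟩ := hsurj k (by omega)
    push_cast at hW
    rcases x with _ | i
    · have : d = 0 := by linarith
      subst this
      linarith
    · have := hupp i
      linarith

theorem progression_injective (hd : 0 < d)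
    (hsurj : ∀ k ≤ n, ∃ x, W x = a + k * d) : Function.Injective W := by
  rw [← Set.injOn_univ, ← Finset.coe_univ, ← Finset.card_image_iff]
  refine le_antisymm Finset.card_image_le ?_
  have hinj : Function.Injective fun k : ℕ => a + (k : ℤ) * d := by
    intro j k h
    simpa [hd.ne'] using h
  calc (Finset.univ : Finset (Option (Fin n))).card
      = ((Finset.range (n + 1)).image fun k : ℕ => a + (k : ℤ) * d).card := by
        rw [Finset.card_image_of_injective _ hinj]
        simp
    _ ≤ _ := by
        refine Finset.card_le_card fun w hw => ?_
        obtain ⟨k, hk, rfl⟩ := Finset.mem_image.1 hw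
        obtain ⟨x, hx⟩ := hsurj k (by simpa [Nat.lt_succ_iff] using hk)
        exact Finset.mem_image.2 ⟨x, Finset.mem_univ _, hx⟩

end Progression

theorem not_progression_fan_three {g : Option (Fin 3) → ℕ} (hg : Function.Injective g)
    {a d : ℤ} (hd : 0 ≤ d)
    (hmem : ∀ x, ∃ k ≤ 3, (wt (fanGraph 3) g x : ℤ) = a + (k : ℕ) * d)
    (hsurj : ∀ k ≤ 3, ∃ x, (wt (fanGraph 3) g x : ℤ) = a + (k : ℕ) * d) : False := by
  have w₀ : wt (fanGraph 3) g (some 0) = g none + g (some 1) := by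
    simp [wt_fanGraph_some]
  have w₁ : wt (fanGraph 3) g (some 1) = g none + g (some 2) + g (some 0) := by
    simp [wt_fanGraph_some]
  have w₂ : wt (fanGraph 3) g (some 2) = g none + g (some 1) := by
    simp [wt_fanGraph_some]
  rcases hd.eq_or_lt with rfl | hd
  · obtain ⟨_, -, h⟩ := hmem none
    obtain ⟨_, -, h₁⟩ := hmem (some 1)
    rw [wt_fanGraph_none, Fin.sum_univ_three] at h
    rw [w₁] at h₁
    have : g none ≠ g (some 1) := hg.ne (by simp)
    push_cast at h h₁
    omega
  · have := progression_injective hd hsurj (a₁ := some 0) (a₂ := some 2) (by rw [w₀, w₂])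
    simp at this

theorem not_progression_fan_five {g : Option (Fin 5) → ℕ} (hg : Function.Injective g)
    (hle : ∀ x, g x ≤ 6) (hsum : ∑ i, g (some i) + g none = 21)
    {a d : ℤ} (hd : 0 ≤ d) (hd₂ : d ≤ 2)
    (hmem : ∀ x, ∃ k ≤ 5, (wt (fanGraph 5) g x : ℤ) = a + (k : ℕ) * d)
    (hsurj : ∀ k ≤ 5, ∃ x, (wt (fanGraph 5) g x : ℤ) = a + (k : ℕ) * d) : False := by
  have w₀ : wt (fanGraph 5) g (some 0) = g none + g (some 1) := by
    simp [wt_fanGraph_some]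
  have w₂ : wt (fanGraph 5) g (some 2) = g none + g (some 3) + g (some 1) := by
    simp [wt_fanGraph_some]
  have w₄ : wt (fanGraph 5) g (some 4) = g none + g (some 3) := by
    simp [wt_fanGraph_some]
  have w : wt (fanGraph 5) g none + g none = 21 := by rw [wt_fanGraph_none, hsum]
  obtain ⟨k₀, l₀, h₀⟩ := hmem (some 0)
  obtain ⟨k₂, l₂, h₂⟩ := hmem (some 2)
  obtain ⟨k₄, l₄, h₄⟩ := hmem (some 4)
  obtain ⟨k, l, h⟩ := hmem none
  have n₁₃ : g (some 1) ≠ g (some 3) := hg.ne (by decide)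
  have n₁ : g (some 1) ≠ g none := hg.ne (by decide)
  have n₃ : g (some 3) ≠ g none := hg.ne (by decide)
  have b := hle none
  have b₁ := hle (some 1)
  have b₃ := hle (some 3)
  rcases hd.eq_or_lt with rfl | hd
  · omega
  · have hne : wt (fanGraph 5) g none ≠ wt (fanGraph 5) g (some 2) := fun e =>
      absurd (progression_injective hd hsurj (a₁ := none) (a₂ := some 2) (by rw [e])) (by simp)
    obtain rfl | rfl : d = 1 ∨ d = 2 := by omega
    · omega
    · omega

theorem eq_two_or_eq_four_of_ADDistanceAntimagic {n : ℕ} (hn : 2 ≤ n) {a d : ℤ} (hd : 0 ≤ d)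
    (h : ADDistanceAntimagic (fanGraph n) a d) : n = 2 ∨ n = 4 := by
  obtain ⟨f, hf⟩ := h
  have hcard : Fintype.card (Option (Fin n)) = n + 1 := by simp
  have hinj : Function.Injective fun y => (f y : ℕ) + 1 := fun x y e =>
    f.injective (Fin.ext (Nat.succ_injective e))
  have hpos : ∀ x, 1 ≤ (f x : ℕ) + 1 := fun x => by omega
  have hle : ∀ x, (f x : ℕ) + 1 ≤ n + 1 := fun x => by have := (f x).2; omega
  set g : Option (Fin n) → ℕ := fun y => (f y : ℕ) + 1
  have hsum : 2 * (g none + ∑ i, g (some i)) = (n + 1) * (n + 1 + 1) := by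
    rw [← hcard, ← two_mul_sum_add_one f, Fintype.sum_option]
  have hmem : ∀ x, ∃ k ≤ n, (wt (fanGraph n) g x : ℤ) = a + (k : ℕ) * d := by
    intro x
    have := hf.subset (Finset.mem_image_of_mem _ (Finset.mem_univ x))
    obtain ⟨k, hk, e⟩ := Finset.mem_image.1 this
    rw [Finset.mem_range, hcard] at hk
    exact ⟨k, by omega, e.symm⟩
  have hsurj : ∀ k ≤ n, ∃ x, (wt (fanGraph n) g x : ℤ) = a + (k : ℕ) * d := by
    intro k hk
    have := hf.superset (Finset.mem_image_of_mem _ (Finset.mem_range.2 (by omega : k < _)))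
    obtain ⟨x, -, e⟩ := Finset.mem_image.1 this
    exact ⟨x, e⟩
  have hb := wt_fanGraph_some_bounds hn hinj hpos hle
  obtain h | rfl | h : n = 2 ∨ n = 3 ∨ 4 ≤ n := by omega
  · exact Or.inl h
  · exact (not_progression_fan_three hinj hd hmem hsurj).elim
  have hd₂ : d ≤ 2 := progression_step_le (m := g none + 1) h hd hsurj
    (fun i => by have := hb i; omega) (fun i => by have := hb i; omega)
  have hc := progression_center_le (M := 3 * n) (by omega) hd hmem hsurj
    (fun i => by have := hb i; omega)
  rw [wt_fanGraph_none] at hc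
  have hcenter : g none ≤ n + 1 := hle none
  have hn₅ : n ≤ 5 := by
    by_contra! h₆
    have : ∑ i, g (some i) ≤ 3 * n + 2 := by omega
    nlinarith
  obtain rfl | rfl : n = 4 ∨ n = 5 := by omega
  · exact Or.inr rfl
  · refine (not_progression_fan_five hinj hle ?_ hd hd₂ hmem hsurj).elim
    omega

theorem fan_two_ADDistanceAntimagic : ADDistanceAntimagic (fanGraph 2) 3 1 := by
  refine ⟨(finSuccEquivLast (n := 2)).symm, ?_⟩
  have hW : (fun x => (wt (fanGraph 2)
      (fun y => ((finSuccEquivLast (n := 2)).symm y : ℕ) + 1) x : ℤ)) =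
      fun x => x.elim 3 ![5, 4] := by
    funext x
    rcases x with _ | x
    · simp [wt_fanGraph_none, Fin.sum_univ_succ]
    · fin_cases x <;> simp [wt_fanGraph_some]
  exact (congrArg (Finset.univ.image ·) hW).trans (by decide)

theorem fan_four_ADDistanceAntimagic : ADDistanceAntimagic (fanGraph 4) 7 1 := by
  refine ⟨(finSuccEquivLast (n := 4)).symm, ?_⟩
  have hW : (fun x => (wt (fanGraph 4)
      (fun y => ((finSuccEquivLast (n := 4)).symm y : ℕ) + 1) x : ℤ)) =
      fun x => x.elim 10 ![7, 9, 11, 8] := by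
    funext x
    rcases x with _ | x
    · simp [wt_fanGraph_none, Fin.sum_univ_succ]
    · fin_cases x <;> simp [wt_fanGraph_some]
  exact (congrArg (Finset.univ.image ·) hW).trans (by decide)

/-- For `n ≥ 2`, the fan `Fₙ` admits an `(a,d)`-distance antimagic labeling for
some `a` and `d ≥ 0` if and only if `n = 2` or `n = 4`. -/
theorem fan_ADDistanceAntimagic_iff (n : ℕ) (hn : 2 ≤ n) :
    (∃ a d : ℤ, 0 ≤ d ∧ ADDistanceAntimagic (fanGraph n) a d) ↔ (n = 2 ∨ n = 4) := by
  constructor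
  · rintro ⟨a, d, hd, h⟩
    exact eq_two_or_eq_four_of_ADDistanceAntimagic hn hd h
  · rintro (rfl | rfl)
    · exact ⟨3, 1, by norm_num, fan_two_ADDistanceAntimagic⟩
    · exact ⟨7, 1, by norm_num, fan_four_ADDistanceAntimagic⟩
end

section
/- For n \geq 1, the friendship graph f_n admits an (a,d)-distance antimagic labeling for some integers a and d \geq 0 if and only if n = 1 or n = 2. -/
/-- The friendship graph `fₙ`: `n` triangles sharing the common vertex `none`;
the `i`-th triangle consists of `none`, `some (i, false)`, and `some (i, true)`. -/
def friendshipGraph (n : ℕ) : SimpleGraph (Option (Fin n × Bool)) :=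
  SimpleGraph.fromRel fun x y =>
    match x, y with
    | none, some _ => True
    | some p, some q => p.1 = q.1
    | _, _ => False

theorem wt_friendshipGraph {n : ℕ} (f : Option (Fin n × Bool) → ℕ)
    (x : Option (Fin n × Bool)) :
    wt (friendshipGraph n) f x =
      x.elim (∑ p, f (some p)) fun p => f none + f (some (p.1, !p.2)) := by
  classical
  rcases x with _ | ⟨i, b⟩
  · simp [wt, friendshipGraph, Fintype.sum_option, Set.indicator_apply]
  · have hleaf : ∀ p : Fin n × Bool, (friendshipGraph n).Adj (some (i, b)) (some p) ↔
        p = (i, !b) := by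
      rintro ⟨j, b'⟩
      simp only [friendshipGraph, SimpleGraph.fromRel_adj, ne_eq, Option.some.injEq,
        Prod.mk.injEq]
      cases b <;> cases b' <;> simp [eq_comm]
    have hcenter : (friendshipGraph n).Adj (some (i, b)) none := by
      simp [friendshipGraph]
    simp [wt, Fintype.sum_option, Set.indicator_apply, hleaf, hcenter]

/-- The labeling of the friendship graph giving the largest label to the center. -/
def centerLast (n : ℕ) (x : Option (Fin n × Bool)) :
    Fin (Fintype.card (Option (Fin n × Bool))) :=
  ⟨x.elim (2 * n) fun p => 2 * p.1 + p.2.toNat, by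
    rcases x with _ | ⟨i, _ | _⟩ <;> simp <;> omega⟩

theorem centerLast_bijective (n : ℕ) : Function.Bijective (centerLast n) := by
  refine (Fintype.bijective_iff_injective_and_card _).2 ⟨?_, by simp⟩
  rintro (_ | ⟨i, _ | _⟩) (_ | ⟨j, _ | _⟩) h <;>
    simp [centerLast, Fin.ext_iff] at h ⊢ <;> omega

theorem ADDistanceAntimagic_friendshipGraph_one :
    ADDistanceAntimagic (friendshipGraph 1) 3 1 := by
  refine ⟨Equiv.ofBijective _ (centerLast_bijective 1), ?_⟩
  simp only [wt_friendshipGraph, Equiv.ofBijective_apply]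
  decide

theorem ADDistanceAntimagic_friendshipGraph_two :
    ADDistanceAntimagic (friendshipGraph 2) 6 1 := by
  refine ⟨Equiv.ofBijective _ (centerLast_bijective 2), ?_⟩
  simp only [wt_friendshipGraph, Equiv.ofBijective_apply]
  decide

theorem not_ADDistanceAntimagic_friendshipGraph {n : ℕ} (hn : 3 ≤ n) {a d : ℤ} (hd : 0 ≤ d) :
    ¬ ADDistanceAntimagic (friendshipGraph n) a d := by
  rintro ⟨f, hf⟩
  have hcard : Fintype.card (Option (Fin n × Bool)) = 2 * n + 1 := by
    simp [mul_comm]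
  simp only [wt_friendshipGraph] at hf
  have hlt : ∀ x, (f x : ℕ) < 2 * n + 1 := fun x => hcard ▸ (f x).isLt
  obtain ⟨c, hc⟩ : ∃ c : ℕ, (f none : ℕ) = c := ⟨_, rfl⟩
  have hcn : c < 2 * n + 1 := hc ▸ hlt none
  -- every leaf label shifted by the center label is a weight
  have hleaf : ∀ m < 2 * n + 1, m ≠ c → ∃ i : ℕ, a + i * d = c + m + 2 := by
    intro m hm hmc
    obtain ⟨x, hx⟩ := f.surjective ⟨m, hcard ▸ hm⟩
    rcases x with _ | ⟨i, b⟩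
    · exact absurd (by rw [← hc, hx]) hmc
    · have hmem := hf.subset (Finset.mem_image_of_mem _ (Finset.mem_univ (some (i, !b))))
      simp only [Option.elim_some, Bool.not_not, hx, hc, Finset.mem_image] at hmem
      obtain ⟨k, -, hk⟩ := hmem
      exact ⟨k, by push_cast at hk; linarith⟩
  have hd1 : d = 1 := by
    obtain ⟨m, hm, hmc, hmc'⟩ : ∃ m, m + 1 < 2 * n + 1 ∧ m ≠ c ∧ m + 1 ≠ c := by
      by_cases h : c ≤ 1
      · exact ⟨2, by omega, by omega, by omega⟩
      by_cases h' : c = 2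
      · exact ⟨3, by omega, by omega, by omega⟩
      · exact ⟨0, by omega, by omega, by omega⟩
    obtain ⟨i, hi⟩ := hleaf m (by omega) hmc
    obtain ⟨j, hj⟩ := hleaf (m + 1) hm hmc'
    refine Int.eq_one_of_dvd_one hd ⟨(j : ℤ) - i, ?_⟩
    push_cast at hj
    linarith
  subst hd1
  obtain ⟨W, hW⟩ : ∃ W : ℕ, ∑ p, ((f (some p) : ℕ) + 1) = W := ⟨_, rfl⟩
  have hsum : W + (c + 1) = (2 * n + 1) * (n + 1) := by
    have h1 : ∑ x, ((f x : ℕ) + 1) = ∑ i ∈ Finset.range (2 * n + 1), (i + 1) := by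
      rw [Equiv.sum_comp f fun i => (i : ℕ) + 1, Fin.sum_univ_eq_sum_range (· + 1), hcard]
    rw [Fintype.sum_option, hW, hc, Finset.sum_add_distrib] at h1
    have h2 := Finset.sum_range_id_mul_two (2 * n + 1)
    simp only [Nat.add_sub_cancel, Finset.sum_const, Finset.card_range, smul_eq_mul] at h1 h2
    nlinarith
  have hbig : c + 2 * n + 3 < W := by nlinarith
  have hWmem := hf.subset (Finset.mem_image_of_mem _ (Finset.mem_univ none))
  simp only [Option.elim_none, hW, Finset.mem_image, Finset.mem_range] at hWmem
  obtain ⟨k, hk, hkW⟩ := hWmem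
  obtain ⟨m, hm, hmc⟩ : ∃ m < 2 * n + 1, m ≠ c := by
    by_cases h : c = 0
    · exact ⟨1, by omega, by omega⟩
    · exact ⟨0, by omega, by omega⟩
  obtain ⟨i, hi⟩ := hleaf m hm hmc
  have hprev : (W : ℤ) - 1 ∈ (Finset.range (Fintype.card (Option (Fin n × Bool)))).image
      fun i : ℕ => a + (i : ℤ) * 1 :=
    Finset.mem_image.2 ⟨k - 1, Finset.mem_range.2 (by omega), by omega⟩
  rw [← hf, Finset.mem_image] at hprev
  obtain ⟨x, -, hx⟩ := hprev
  rcases x with _ | ⟨j, b⟩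
  · simp only [Option.elim_none, hW] at hx
    omega
  · have := hlt (some (j, !b))
    simp only [Option.elim_some, hc] at hx
    omega

/-- For `n ≥ 1`, the friendship graph `fₙ` admits an `(a,d)`-distance antimagic
labeling for some `a` and `d ≥ 0` if and only if `n = 1` or `n = 2`. -/
theorem friendship_ADDistanceAntimagic_iff (n : ℕ) (hn : 1 ≤ n) :
    (∃ a d : ℤ, 0 ≤ d ∧ ADDistanceAntimagic (friendshipGraph n) a d) ↔
      (n = 1 ∨ n = 2) := by
  constructor
  · rintro ⟨a, d, hd, h⟩
    by_contra hne
    exact not_ADDistanceAntimagic_friendshipGraph (by omega) hd h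
  · rintro (rfl | rfl)
    · exact ⟨3, 1, zero_le_one, ADDistanceAntimagic_friendshipGraph_one⟩
    · exact ⟨6, 1, zero_le_one, ADDistanceAntimagic_friendshipGraph_two⟩
end

section
/- For every n \geq 1, the friendship graph f_n is distance antimagic; that is, there exists a bijection f : V(f_n) \to {1, ..., 2n+1} for which the vertex-weights w(x) = \sum_{y \in N(x)} f(y) are pairwise distinct. -/
/-- A graph is distance antimagic if there is a bijection from the vertices onto
`{1, …, v}` (encoded via an equivalence with `Fin v`, the label of `y` being
`f y + 1`) such that all vertex-weights are pairwise distinct. -/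
def DistanceAntimagic {α : Type*} [Fintype α] (G : SimpleGraph α) : Prop :=
  ∃ f : α ≃ Fin (Fintype.card α),
    Function.Injective fun x => wt G (fun y => (f y : ℕ) + 1) x

lemma friendshipGraph_adj_none_some {n : ℕ} (p : Fin n × Bool) :
    (friendshipGraph n).Adj none (some p) := by
  simp [friendshipGraph]

lemma friendshipGraph_adj_some_some {n : ℕ} (p q : Fin n × Bool) :
    (friendshipGraph n).Adj (some p) (some q) ↔ q = (p.1, !p.2) := by
  obtain ⟨i, a⟩ := p
  obtain ⟨j, b⟩ := q
  cases a <;> cases b <;> simp [friendshipGraph, eq_comm]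

lemma wt_friendshipGraph_none {n : ℕ} (f : Option (Fin n × Bool) → ℕ) :
    wt (friendshipGraph n) f none = ∑ p, f (some p) := by
  simp [wt, Fintype.sum_option, friendshipGraph_adj_none_some]

lemma wt_friendshipGraph_some {n : ℕ} (f : Option (Fin n × Bool) → ℕ) (p : Fin n × Bool) :
    wt (friendshipGraph n) f (some p) = f none + f (some (p.1, !p.2)) := by
  classical
  simp [wt, Fintype.sum_option, Set.indicator_apply, friendshipGraph_adj_some_some,
    (friendshipGraph_adj_none_some p).symm]

/-- The weights are distinct as soon as the center carries the smallest label. -/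
lemma wt_friendshipGraph_injective {n : ℕ} {f : Option (Fin n × Bool) → ℕ}
    (hf : Function.Injective f) (hmin : ∀ p, f none < f (some p)) :
    Function.Injective (wt (friendshipGraph n) f) := by
  have hne (p : Fin n × Bool) :
      wt (friendshipGraph n) f (some p) < wt (friendshipGraph n) f none := by
    rw [wt_friendshipGraph_some, wt_friendshipGraph_none]
    have hp : p ≠ (p.1, !p.2) := fun h => by simpa using congrArg Prod.snd h
    calc f none + f (some (p.1, !p.2)) < f (some p) + f (some (p.1, !p.2)) := by
          gcongr
          exact hmin p
      _ = ∑ q ∈ {p, (p.1, !p.2)}, f (some q) :=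
          (Finset.sum_pair (f := fun q => f (some q)) hp).symm
      _ ≤ ∑ q, f (some q) := Finset.sum_le_sum_of_subset (Finset.subset_univ _)
  rintro (_ | p) (_ | q) h
  · rfl
  · exact absurd h (hne q).ne'
  · exact absurd h (hne p).ne
  · rw [wt_friendshipGraph_some, wt_friendshipGraph_some] at h
    have h' := hf (Nat.add_left_cancel h)
    simp only [Option.some.injEq, Prod.mk.injEq] at h'
    exact congrArg some (Prod.ext h'.1 (by simpa using h'.2))

/-- Every friendship graph `fₙ` (`n ≥ 1`) is distance antimagic. -/
theorem friendship_distanceAntimagic (n : ℕ) (hn : 1 ≤ n) :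
    DistanceAntimagic (friendshipGraph n) := by
  let e := Fintype.equivFin (Option (Fin n × Bool))
  let z : Fin (Fintype.card (Option (Fin n × Bool))) := ⟨0, Fintype.card_pos⟩
  let f := e.trans (Equiv.swap (e none) z)
  have hz : f none = z := by simp [f]
  refine ⟨f, wt_friendshipGraph_injective (fun x y h => ?_) fun p => ?_⟩
  · exact f.injective (Fin.ext (Nat.add_right_cancel h))
  · have hp : f (some p) ≠ z := fun h => by simpa using f.injective (h.trans hz.symm)
    have hv : (f (some p) : ℕ) ≠ 0 := fun h => hp (Fin.ext h)
    have h0 : (f none : ℕ) = 0 := congrArg Fin.val hz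
    omega
end
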